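/- arXiv:1205.5934 — 3 statements merged into one kernel-verified Lean document; each statement's English description precedes it below -/
import Mathlib

section
/- Let U ⊂ ℝ² be open, let 0 < p < 2, q = 3/(2−p), θ = (1+p)/(2−p), let h : U → ℝ, let g : U → ℝ be strictly positive and of class C², and set f = (q^{−2/3}·g)^q. Then f satisfies det D²f = h·f^p on U if and only if g satisfies g·det D²g + θ·(g_y²·g_xx − 2·g_x·g_y·g_xy + g_x²·g_yy) = h on U. -/
open Set Real

noncomputable section

/-- Partial derivative in the first (x) variable. -/
def pdx (g : ℝ × ℝ → ℝ) (P : ℝ × ℝ) : ℝ := fderiv ℝ g P (1, 0)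

/-- Partial derivative in the second (y) variable. -/
def pdy (g : ℝ × ℝ → ℝ) (P : ℝ × ℝ) : ℝ := fderiv ℝ g P (0, 1)

def pdxx (g : ℝ × ℝ → ℝ) : ℝ × ℝ → ℝ := pdx (pdx g)
def pdxy (g : ℝ × ℝ → ℝ) : ℝ × ℝ → ℝ := pdy (pdx g)
def pdyy (g : ℝ × ℝ → ℝ) : ℝ × ℝ → ℝ := pdy (pdy g)

/-- Determinant of the Hessian matrix. -/
def detD2 (g : ℝ × ℝ → ℝ) (P : ℝ × ℝ) : ℝ := pdxx g P * pdyy g P - (pdxy g P) ^ 2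

/-- The degenerate Monge–Ampère pressure operator
`P_θ[g] = g·det D²g + θ·(g_y²·g_xx − 2·g_x·g_y·g_xy + g_x²·g_yy)`. -/
def Pop (θ : ℝ) (g : ℝ × ℝ → ℝ) (P : ℝ × ℝ) : ℝ :=
  g P * detD2 g P +
    θ * ((pdy g P) ^ 2 * pdxx g P - 2 * pdx g P * pdy g P * pdxy g P +
      (pdx g P) ^ 2 * pdyy g P)

/-- `Ω(g) = {x ∈ Ω : g x > 0}`. -/
def posSet (Ω : Set (ℝ × ℝ)) (g : ℝ × ℝ → ℝ) : Set (ℝ × ℝ) := {x | x ∈ Ω ∧ 0 < g x}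

/-- `Λ(g) = {x ∈ Ω : g x = 0}`. -/
def zeroSet (Ω : Set (ℝ × ℝ)) (g : ℝ × ℝ → ℝ) : Set (ℝ × ℝ) := {x | x ∈ Ω ∧ g x = 0}

/-- `Γ(g) = ∂Λ(g)`. -/
def interfaceSet (Ω : Set (ℝ × ℝ)) (g : ℝ × ℝ → ℝ) : Set (ℝ × ℝ) := frontier (zeroSet Ω g)

/-- `|Dg|²`. -/
def gradSq (g : ℝ × ℝ → ℝ) (P : ℝ × ℝ) : ℝ := (pdx g P) ^ 2 + (pdy g P) ^ 2

/-- Second derivative `g_νν` in the outward normal direction `ν = Dg/|Dg|` of the level sets. -/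
def dnn (g : ℝ × ℝ → ℝ) (P : ℝ × ℝ) : ℝ :=
  ((pdx g P) ^ 2 * pdxx g P + 2 * pdx g P * pdy g P * pdxy g P +
    (pdy g P) ^ 2 * pdyy g P) / gradSq g P

/-- Mixed second derivative `g_ντ` in the normal/tangential directions of the level sets. -/
def dnt (g : ℝ × ℝ → ℝ) (P : ℝ × ℝ) : ℝ :=
  (pdx g P * pdy g P * (pdyy g P - pdxx g P) +
    ((pdx g P) ^ 2 - (pdy g P) ^ 2) * pdxy g P) / gradSq g P

/-- Second derivative `g_ττ` in the tangential direction of the level sets. -/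
def dtt (g : ℝ × ℝ → ℝ) (P : ℝ × ℝ) : ℝ :=
  ((pdy g P) ^ 2 * pdxx g P - 2 * pdx g P * pdy g P * pdxy g P +
    (pdx g P) ^ 2 * pdyy g P) / gradSq g P

/-- `u` extends continuously and boundedly from `S` to `closure S`. -/
def ExtendsContBdd (S : Set (ℝ × ℝ)) (u : ℝ × ℝ → ℝ) : Prop :=
  ∃ U : ℝ × ℝ → ℝ, ContinuousOn U (closure S) ∧ (∀ x ∈ S, U x = u x) ∧
    ∃ M : ℝ, ∀ x ∈ closure S, |U x| ≤ M

/-- The density `f = (q^{-2/3}·g)^q` associated to a pressure `g`. -/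
def pressureToDensity (q : ℝ) (g : ℝ × ℝ → ℝ) : ℝ × ℝ → ℝ :=
  fun P => (q ^ (-(2 : ℝ) / 3) * g P) ^ q

/-- The pressure `g = q^{2/3}·f^{1/q}` associated to a density `f`. -/
def densityToPressure (q : ℝ) (f : ℝ × ℝ → ℝ) : ℝ × ℝ → ℝ :=
  fun P => q ^ ((2 : ℝ) / 3) * (f P) ^ (1 / q)

/-- A classical solution (with `rel := Eq`), super-solution (`rel := (· ≤ ·)`) or
sub-solution (`rel := (· ≥ ·)`) of `P_θ[g] = h·χ_{{g>0}}` on `Ω`. -/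
structure ClassicalRelSolution (θ q : ℝ) (Ω : Set (ℝ × ℝ)) (h g : ℝ × ℝ → ℝ)
    (rel : ℝ → ℝ → Prop) : Prop where
  nonneg : ∀ x ∈ Ω, 0 ≤ g x
  lip : ∃ K : NNReal, LipschitzOnWith K g Ω
  smooth : ContDiffOn ℝ 2 g (posSet Ω g)
  ext_g : ExtendsContBdd (posSet Ω g) g
  ext_gx : ExtendsContBdd (posSet Ω g) (pdx g)
  ext_gy : ExtendsContBdd (posSet Ω g) (pdy g)
  ext_gnn : ExtendsContBdd (posSet Ω g) (fun P => g P * dnn g P)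
  ext_gnt : ExtendsContBdd (posSet Ω g) (fun P => Real.sqrt (g P) * dnt g P)
  ext_gtt : ExtendsContBdd (posSet Ω g) (dtt g)
  convex_f : ConvexOn ℝ Ω (pressureToDensity q g)
  rel_pos : ∀ x ∈ posSet Ω g, rel (Pop θ g x) (h x)
  rel_interface : ∃ U : ℝ × ℝ → ℝ, ContinuousOn U (closure (posSet Ω g)) ∧
    (∀ x ∈ posSet Ω g, U x = Pop θ g x) ∧ ∀ x ∈ interfaceSet Ω g, rel (U x) (h x)

/-- Euclidean open ball of radius `r` centered at the origin of `ℝ²`. -/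
def eball (r : ℝ) : Set (ℝ × ℝ) := {x : ℝ × ℝ | x.1 ^ 2 + x.2 ^ 2 < r ^ 2}

/-- A bounded open strictly convex planar domain with smooth boundary. -/
structure NiceDomain (Ω : Set (ℝ × ℝ)) : Prop where
  isOpen : IsOpen Ω
  bounded : Bornology.IsBounded Ω
  strictConvex : StrictConvex ℝ Ω
  smoothBoundary : ∃ F : ℝ × ℝ → ℝ, ContDiff ℝ (⊤ : ℕ∞) F ∧ Ω = {x | F x < 0} ∧
    ∀ x ∈ frontier Ω, fderiv ℝ F x ≠ 0

/-- Hypotheses (H-1)–(H-4). -/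
structure HypH (ρ q : ℝ) (Ω : Set (ℝ × ℝ)) (g : ℝ × ℝ → ℝ) : Prop where
  rho_pos : 0 < ρ
  subset_unit_ball : Ω ⊆ eball 1
  zero_nonempty : (zeroSet Ω g).Nonempty
  zero_compactly_contained : closure (zeroSet Ω g) ⊆ Ω
  ball_subset_zero : eball ρ ⊆ zeroSet Ω g
  density_pos : ∀ x ∈ posSet Ω g, 0 < pressureToDensity q g x
  density_strictly_convex : ∀ x ∈ posSet Ω g, 0 < detD2 (pressureToDensity q g) x
  smooth4 : ContDiffOn ℝ 4 g (closure (posSet Ω g))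

/-- `C²` bound on a set, in terms of partial derivatives up to order two. -/
def C2BoundOn (S : Set (ℝ × ℝ)) (u : ℝ × ℝ → ℝ) (K : ℝ) : Prop :=
  ∀ x ∈ S, |u x| + |pdx u x| + |pdy u x| + |pdxx u x| + |pdxy u x| + |pdyy u x| ≤ K

/-- `C¹` bound on a set. -/
def C1BoundOn (S : Set (ℝ × ℝ)) (u : ℝ × ℝ → ℝ) (K : ℝ) : Prop :=
  ∀ x ∈ S, |u x| + |pdx u x| + |pdy u x| ≤ K

/-- The quadratic form `a ξ₁² + 2b ξ₁ξ₂ + c ξ₂²` of the symmetric matrix `[[a,b],[b,c]]`. -/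
def quadForm (a b c : ℝ) (ξ : ℝ × ℝ) : ℝ := a * ξ.1 ^ 2 + 2 * b * ξ.1 * ξ.2 + c * ξ.2 ^ 2

/-- Iterated mixed partial derivative, one derivative (in x if `true`, in y if `false`)
per entry of the list. -/
def mixedPartial : List Bool → (ℝ × ℝ → ℝ) → (ℝ × ℝ → ℝ)
  | [], g => g
  | b :: L, g => mixedPartial L (if b then pdx g else pdy g)

/-- A set is a smooth embedded curve: locally a regular level set of a smooth function. -/
def SmoothCurve (Γ : Set (ℝ × ℝ)) : Prop :=
  ∀ x ∈ Γ, ∃ (U : Set (ℝ × ℝ)) (F : ℝ × ℝ → ℝ), IsOpen U ∧ x ∈ U ∧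
    ContDiff ℝ (⊤ : ℕ∞) F ∧ (∀ y ∈ U, fderiv ℝ F y ≠ 0) ∧ Γ ∩ U = {y | y ∈ U ∧ F y = 0}


/-- Second directional derivative of a constant multiple of a real power of a positive function. -/
theorem fderiv_fderiv_const_mul_rpow {U : Set (ℝ × ℝ)} {f g : ℝ × ℝ → ℝ} {c q : ℝ}
    (hU : IsOpen U) (hg : ContDiffOn ℝ 2 g U) (hgpos : ∀ x ∈ U, 0 < g x)
    (hf : ∀ x ∈ U, f x = c * g x ^ q) {x : ℝ × ℝ} (hx : x ∈ U) (v w : ℝ × ℝ) :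
    fderiv ℝ (fun y => fderiv ℝ f y v) x w = c * q * g x ^ (q - 2) *
      (g x * fderiv ℝ (fun y => fderiv ℝ g y v) x w +
        (q - 1) * (fderiv ℝ g x v * fderiv ℝ g x w)) := by
  have hdiff : ∀ y ∈ U, DifferentiableAt ℝ g y := fun y hy =>
    (hg.differentiableOn (by norm_num)).differentiableAt (hU.mem_nhds hy)
  have hrpow : ∀ r : ℝ, ∀ y ∈ U,
      HasFDerivAt (fun z => g z ^ r) ((r * g y ^ (r - 1)) • fderiv ℝ g y) y := fun r y hy =>
    (hdiff y hy).hasFDerivAt.rpow_const (Or.inl (hgpos y hy).ne')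
  have hfirst : (fun y => fderiv ℝ f y v) =ᶠ[nhds x]
      fun y => c * q * (g y ^ (q - 1) * fderiv ℝ g y v) := by
    filter_upwards [hU.mem_nhds hx] with y hy
    have heq : f =ᶠ[nhds y] fun z => c * g z ^ q :=
      Filter.eventuallyEq_of_mem (hU.mem_nhds hy) hf
    rw [heq.fderiv_eq, ((hrpow q y hy).const_mul c).fderiv]
    simp only [smul_apply, smul_eq_mul]
    ring
  have hsecond : DifferentiableAt ℝ (fun y => fderiv ℝ g y v) x :=
    (((hg.fderiv_of_isOpen hU (m := 1) (by norm_num)).differentiableOn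
      (by norm_num)).differentiableAt (hU.mem_nhds hx)).clm_apply (differentiableAt_const v)
  rw [hfirst.fderiv_eq,
    (((hrpow (q - 1) x hx).fun_mul hsecond.hasFDerivAt).const_mul (c * q)).fderiv]
  have hpow : g x ^ (q - 1) = g x ^ (q - 2) * g x := by
    rw [← rpow_add_one (hgpos x hx).ne']
    congr 1
    ring
  simp only [smul_apply, add_apply, smul_eq_mul]
  rw [hpow, show q - 1 - 1 = q - 2 by ring]
  ring

/-- The Hessian determinant of a constant multiple of a real power of a positive function. -/
theorem detD2_const_mul_rpow {U : Set (ℝ × ℝ)} {f g : ℝ × ℝ → ℝ} {c q : ℝ}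
    (hU : IsOpen U) (hg : ContDiffOn ℝ 2 g U) (hgpos : ∀ x ∈ U, 0 < g x)
    (hf : ∀ x ∈ U, f x = c * g x ^ q) {x : ℝ × ℝ} (hx : x ∈ U) :
    detD2 f x = c ^ 2 * q ^ 2 * g x ^ (2 * q - 3) * Pop (q - 1) g x := by
  have key := fderiv_fderiv_const_mul_rpow hU hg hgpos hf hx
  have hxx : pdxx f x = c * q * g x ^ (q - 2) *
      (g x * pdxx g x + (q - 1) * (pdx g x * pdx g x)) := key (1, 0) (1, 0)
  have hxy : pdxy f x = c * q * g x ^ (q - 2) *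
      (g x * pdxy g x + (q - 1) * (pdx g x * pdy g x)) := key (1, 0) (0, 1)
  have hyy : pdyy f x = c * q * g x ^ (q - 2) *
      (g x * pdyy g x + (q - 1) * (pdy g x * pdy g x)) := key (0, 1) (0, 1)
  have hpow : g x ^ (2 * q - 3) = g x ^ (q - 2) * g x ^ (q - 2) * g x := by
    rw [← rpow_add (hgpos x hx), ← rpow_add_one (hgpos x hx).ne']
    congr 1
    ring
  rw [detD2, hxx, hxy, hyy, hpow, Pop, detD2]
  ring

theorem detD2_pressureToDensity {U : Set (ℝ × ℝ)} {p : ℝ} {g : ℝ × ℝ → ℝ}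
    (hU : IsOpen U) (hp2 : p < 2) (hg : ContDiffOn ℝ 2 g U) (hgpos : ∀ x ∈ U, 0 < g x)
    {x : ℝ × ℝ} (hx : x ∈ U) :
    detD2 (pressureToDensity (3 / (2 - p)) g) x =
      Pop ((1 + p) / (2 - p)) g x * pressureToDensity (3 / (2 - p)) g x ^ p := by
  have hp : 0 < 2 - p := by linarith
  have hθ : (1 + p) / (2 - p) = 3 / (2 - p) - 1 := by field_simp; ring
  have hpq : p * (3 / (2 - p)) = 2 * (3 / (2 - p)) - 3 := by field_simp; ring
  have hq : 0 < 3 / (2 - p) := by positivity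
  rw [hθ]
  generalize 3 / (2 - p) = q at *
  have hf : ∀ y ∈ U, pressureToDensity q g y = q ^ (-(2 : ℝ) / 3 * q) * g y ^ q := by
    intro y hy
    rw [pressureToDensity, mul_rpow (by positivity) (hgpos y hy).le, ← rpow_mul hq.le]
  have hc : (q ^ (-(2 : ℝ) / 3 * q)) ^ 2 * q ^ 2 = (q ^ (-(2 : ℝ) / 3 * q)) ^ p := by
    rw [← rpow_natCast, ← rpow_mul hq.le, ← rpow_natCast q 2, ← rpow_add hq, ← rpow_mul hq.le]
    congr 1
    push_cast
    linear_combination (2 / 3) * hpq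
  rw [detD2_const_mul_rpow hU hg hgpos hf hx, hf x hx,
    mul_rpow (by positivity) (rpow_nonneg (hgpos x hx).le _), ← rpow_mul (hgpos x hx).le,
    mul_comm q p, hpq, hc]
  ring

/-- the density `f = (q^{-2/3} g)^q` satisfies `det D²f = h·f^p` on `U`
iff the pressure `g` satisfies `P_θ[g] = h` on `U`. -/
theorem pressure_density_equivalence (U : Set (ℝ × ℝ)) (p : ℝ) (h g : ℝ × ℝ → ℝ)
    (hU : IsOpen U) (hp0 : 0 < p) (hp2 : p < 2)
    (hg : ContDiffOn ℝ 2 g U) (hgpos : ∀ x ∈ U, 0 < g x) :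
    (∀ x ∈ U, detD2 (pressureToDensity (3 / (2 - p)) g) x =
        h x * (pressureToDensity (3 / (2 - p)) g x) ^ p) ↔
      (∀ x ∈ U, Pop ((1 + p) / (2 - p)) g x = h x) := by
  refine forall₂_congr fun x hx => ?_
  have hp : 0 < 2 - p := by linarith
  have hgx := hgpos x hx
  have hf : 0 < pressureToDensity (3 / (2 - p)) g x := by
    unfold pressureToDensity
    positivity
  rw [detD2_pressureToDensity hU hp2 hg hgpos hx]
  exact mul_left_inj' (rpow_pos_of_pos hf p).ne'

end
end

section
/- (Hodograph transformation of the pressure equation.) Let θ > 0, let V ⊂ ℝ² be open, let g : V → ℝ be C² with g > 0 and g_x > 0 on V, and suppose g satisfies g·det D²g + θ·(g_y²·g_xx − 2·g_x·g_y·g_xy + g_x²·g_yy) = h on V for some h : V → ℝ. Let W ⊂ ℝ² be open and let q : W → ℝ be C² with (q(z,y), y) ∈ V and g(q(z,y), y) = z for all (z,y) ∈ W. Then for every (z,y) ∈ W: (−z·det D²q(z,y) + θ·q_z(z,y)·q_yy(z,y)) / q_z(z,y)⁴ = −H(z,y), where H(z,y) = h(q(z,y), y). -/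
open Set Real

noncomputable section

theorem pdx_congr {f g : ℝ × ℝ → ℝ} {S : Set (ℝ × ℝ)} {P : ℝ × ℝ} (hS : IsOpen S) (hP : P ∈ S)
    (h : ∀ x ∈ S, f x = g x) : pdx f P = pdx g P := by
  unfold pdx
  rw [Filter.EventuallyEq.fderiv_eq (Filter.eventually_of_mem (hS.mem_nhds hP) h)]

theorem pdy_congr {f g : ℝ × ℝ → ℝ} {S : Set (ℝ × ℝ)} {P : ℝ × ℝ} (hS : IsOpen S) (hP : P ∈ S)
    (h : ∀ x ∈ S, f x = g x) : pdy f P = pdy g P := by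
  unfold pdy
  rw [Filter.EventuallyEq.fderiv_eq (Filter.eventually_of_mem (hS.mem_nhds hP) h)]

theorem pdx_mul {f g : ℝ × ℝ → ℝ} {P : ℝ × ℝ} (hf : DifferentiableAt ℝ f P)
    (hg : DifferentiableAt ℝ g P) :
    pdx (fun x => f x * g x) P = f P * pdx g P + g P * pdx f P := by
  simp [pdx, fderiv_fun_mul hf hg]

theorem pdy_mul {f g : ℝ × ℝ → ℝ} {P : ℝ × ℝ} (hf : DifferentiableAt ℝ f P)
    (hg : DifferentiableAt ℝ g P) :
    pdy (fun x => f x * g x) P = f P * pdy g P + g P * pdy f P := by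
  simp [pdy, fderiv_fun_mul hf hg]

theorem pdy_add {f g : ℝ × ℝ → ℝ} {P : ℝ × ℝ} (hf : DifferentiableAt ℝ f P)
    (hg : DifferentiableAt ℝ g P) :
    pdy (fun x => f x + g x) P = pdy f P + pdy g P := by
  simp [pdy, fderiv_fun_add hf hg]

theorem hasFDerivAt_graph_comp {F q : ℝ × ℝ → ℝ} {Q : ℝ × ℝ}
    (hF : DifferentiableAt ℝ F (q Q, Q.2)) (hq : DifferentiableAt ℝ q Q) :
    HasFDerivAt (fun x : ℝ × ℝ => F (q x, x.2))
      ((fderiv ℝ F (q Q, Q.2)).comp ((fderiv ℝ q Q).prod (ContinuousLinearMap.snd ℝ ℝ ℝ))) Q :=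
  hF.hasFDerivAt.comp Q (hq.hasFDerivAt.prodMk hasFDerivAt_snd)

theorem clm_apply_prod (L : ℝ × ℝ →L[ℝ] ℝ) (a b : ℝ) : L (a, b) = a * L (1, 0) + b * L (0, 1) := by
  have h : ((a, b) : ℝ × ℝ) = a • (1, 0) + b • (0, 1) := by simp
  rw [h, map_add, map_smul, map_smul, smul_eq_mul, smul_eq_mul]

theorem pdx_graph_comp {F q : ℝ × ℝ → ℝ} {Q : ℝ × ℝ}
    (hF : DifferentiableAt ℝ F (q Q, Q.2)) (hq : DifferentiableAt ℝ q Q) :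
    pdx (fun x : ℝ × ℝ => F (q x, x.2)) Q = pdx F (q Q, Q.2) * pdx q Q := by
  unfold pdx
  rw [(hasFDerivAt_graph_comp hF hq).fderiv]
  simp only [ContinuousLinearMap.comp_apply, ContinuousLinearMap.prod_apply,
    ContinuousLinearMap.coe_snd']
  rw [clm_apply_prod]
  ring

theorem pdy_graph_comp {F q : ℝ × ℝ → ℝ} {Q : ℝ × ℝ}
    (hF : DifferentiableAt ℝ F (q Q, Q.2)) (hq : DifferentiableAt ℝ q Q) :
    pdy (fun x : ℝ × ℝ => F (q x, x.2)) Q =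
      pdx F (q Q, Q.2) * pdy q Q + pdy F (q Q, Q.2) := by
  unfold pdx pdy
  rw [(hasFDerivAt_graph_comp hF hq).fderiv]
  simp only [ContinuousLinearMap.comp_apply, ContinuousLinearMap.prod_apply,
    ContinuousLinearMap.coe_snd']
  rw [clm_apply_prod]
  ring

theorem differentiableAt_fderiv {f : ℝ × ℝ → ℝ} {P : ℝ × ℝ} (hf : ContDiffAt ℝ 2 f P) :
    DifferentiableAt ℝ (fderiv ℝ f) P :=
  (hf.fderiv_right (m := 1) (by norm_num)).differentiableAt (by norm_num)

theorem differentiableAt_pdx {f : ℝ × ℝ → ℝ} {P : ℝ × ℝ} (hf : ContDiffAt ℝ 2 f P) :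
    DifferentiableAt ℝ (pdx f) P :=
  (differentiableAt_fderiv hf).clm_apply (differentiableAt_const _)

theorem differentiableAt_pdy {f : ℝ × ℝ → ℝ} {P : ℝ × ℝ} (hf : ContDiffAt ℝ 2 f P) :
    DifferentiableAt ℝ (pdy f) P :=
  (differentiableAt_fderiv hf).clm_apply (differentiableAt_const _)

theorem pdx_pdy_eq_pdxy {f : ℝ × ℝ → ℝ} {P : ℝ × ℝ} (hf : ContDiffAt ℝ 2 f P) :
    pdx (pdy f) P = pdxy f P := by
  have key (v w : ℝ × ℝ) : fderiv ℝ (fun x => fderiv ℝ f x v) P w =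
      fderiv ℝ (fderiv ℝ f) P w v := by
    rw [fderiv_clm_apply (differentiableAt_fderiv hf) (differentiableAt_const _)]
    simp
  have hsymm : IsSymmSndFDerivAt ℝ f P := hf.isSymmSndFDerivAt (by simp)
  exact (key (0, 1) (1, 0)).trans ((hsymm (1, 0) (0, 1)).trans (key (1, 0) (0, 1)).symm)

theorem hodograph_algebra {θ z gx gy gxx gxy gyy qz qy qzz qzy qyy : ℝ}
    (hz : gx * qz = 1) (hy : gx * qy + gy = 0)
    (hzz : gx * qzz + qz * (gxx * qz) = 0)
    (hzy : gx * qzy + qz * (gxx * qy + gxy) = 0)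
    (hyy : gx * qyy + qy * (gxx * qy + gxy) + (gxy * qy + gyy) = 0) :
    (-z * (qzz * qyy - qzy ^ 2) + θ * qz * qyy) / qz ^ 4 =
      -(z * (gxx * gyy - gxy ^ 2) +
        θ * (gy ^ 2 * gxx - 2 * gx * gy * gxy + gx ^ 2 * gyy)) := by
  have hne : qz ≠ 0 := right_ne_zero_of_mul_eq_one hz
  have hgx : gx = 1 / qz := eq_one_div_of_mul_eq_one_left hz
  have hgy : gy = -(gx * qy) := by linear_combination hy
  have ezz : qzz = -(qz * (qz * (gxx * qz))) := by linear_combination qz * hzz - qzz * hz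
  have ezy : qzy = -(qz * (qz * (gxx * qy + gxy))) := by
    linear_combination qz * hzy - qzy * hz
  have eyy : qyy = -(qz * (qy * (gxx * qy + gxy) + (gxy * qy + gyy))) := by
    linear_combination qz * hyy - qyy * hz
  rw [hgy, ezz, ezy, eyy, hgx]
  field_simp
  ring

/-- hodograph transformation of the pressure equation.  Here the first
variable of `q` plays the role of `z`, so `q_z = pdx q`, `q_y = pdy q`, etc. -/
theorem hodograph_equation (θ : ℝ) (V W : Set (ℝ × ℝ)) (g h q : ℝ × ℝ → ℝ)
    (hθ : 0 < θ) (hV : IsOpen V) (hW : IsOpen W)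
    (hg : ContDiffOn ℝ 2 g V) (hgpos : ∀ P ∈ V, 0 < g P) (hgx : ∀ P ∈ V, 0 < pdx g P)
    (heq : ∀ P ∈ V, Pop θ g P = h P)
    (hq : ContDiffOn ℝ 2 q W)
    (hmem : ∀ Q ∈ W, (q Q, Q.2) ∈ V)
    (hinv : ∀ Q ∈ W, g (q Q, Q.2) = Q.1) :
    ∀ Q ∈ W,
      (-Q.1 * detD2 q Q + θ * pdx q Q * pdyy q Q) / (pdx q Q) ^ 4 = -h (q Q, Q.2) := by
  have hgd (P) (hP : P ∈ V) : ContDiffAt ℝ 2 g P := hg.contDiffAt (hV.mem_nhds hP)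
  have hqd (Q) (hQ : Q ∈ W) : ContDiffAt ℝ 2 q Q := hq.contDiffAt (hW.mem_nhds hQ)
  have hg1 (P) (hP : P ∈ V) : DifferentiableAt ℝ g P := (hgd P hP).differentiableAt (by norm_num)
  have hq1 (Q) (hQ : Q ∈ W) : DifferentiableAt ℝ q Q := (hqd Q hQ).differentiableAt (by norm_num)
  have first_z : ∀ Q ∈ W, pdx g (q Q, Q.2) * pdx q Q = 1 := fun Q hQ => by
    rw [← pdx_graph_comp (hg1 _ (hmem Q hQ)) (hq1 Q hQ), pdx_congr hW hQ hinv]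
    simp [pdx, fderiv_fst]
  have first_y : ∀ Q ∈ W, pdx g (q Q, Q.2) * pdy q Q + pdy g (q Q, Q.2) = 0 := fun Q hQ => by
    rw [← pdy_graph_comp (hg1 _ (hmem Q hQ)) (hq1 Q hQ), pdy_congr hW hQ hinv]
    simp [pdy, fderiv_fst]
  intro Q hQ
  have hgx' := differentiableAt_pdx (hgd _ (hmem Q hQ))
  have hgy' := differentiableAt_pdy (hgd _ (hmem Q hQ))
  have hqx' := differentiableAt_pdx (hqd Q hQ)
  have hqy' := differentiableAt_pdy (hqd Q hQ)
  have hGx : DifferentiableAt ℝ (fun x : ℝ × ℝ => pdx g (q x, x.2)) Q :=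
    (hasFDerivAt_graph_comp hgx' (hq1 Q hQ)).differentiableAt
  have hGy : DifferentiableAt ℝ (fun x : ℝ × ℝ => pdy g (q x, x.2)) Q :=
    (hasFDerivAt_graph_comp hgy' (hq1 Q hQ)).differentiableAt
  have ezz := pdx_congr (g := fun _ => 1) hW hQ first_z
  rw [pdx_mul hGx hqx', pdx_graph_comp hgx' (hq1 Q hQ)] at ezz
  have ezy := pdy_congr (g := fun _ => 1) hW hQ first_z
  rw [pdy_mul hGx hqx', pdy_graph_comp hgx' (hq1 Q hQ)] at ezy
  have eyy := pdy_congr (g := fun _ => 0) hW hQ first_y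
  rw [pdy_add (hGx.fun_mul hqy') hGy, pdy_mul hGx hqy', pdy_graph_comp hgx' (hq1 Q hQ),
    pdy_graph_comp hgy' (hq1 Q hQ), pdx_pdy_eq_pdxy (hgd _ (hmem Q hQ))] at eyy
  have e1 := first_z Q hQ
  have e2 := first_y Q hQ
  have pdx_const (c : ℝ) : pdx (fun _ => c) Q = 0 := by simp [pdx]
  have pdy_const (c : ℝ) : pdy (fun _ => c) Q = 0 := by simp [pdy]
  rw [pdx_const] at ezz
  rw [pdy_const] at ezy eyy
  rw [← heq _ (hmem Q hQ)]
  simp only [Pop, detD2, hinv Q hQ]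
  exact hodograph_algebra e1 e2 ezz ezy eyy

end
end

section
/- (Radial super-solution example.) Let 0 < p < 2, q = 3/(2−p) and 0 < ρ < 1. For c₁ > 0 define ψ₁ : ℝ² → ℝ by ψ₁(P) = c₁·((|P|² − ρ²)₊)^q, where (·)₊ denotes the positive part. Then there exist c₁ > 0 and λ ∈ (0,1) such that for every P ∈ ℝ² with ρ < |P| < 1, ψ₁ is twice differentiable at P and 2·λ < det D²ψ₁(P) / ψ₁(P)^p < 1/2. -/
open Set Real

noncomputable section

/-- Where `ρ² < x² + y²`, a power of the truncated radial function `(x² + y² - ρ²)₊` has the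
gradient given by the chain rule. -/
theorem hasFDerivAt_radial_rpow (ρ a : ℝ) {P : ℝ × ℝ} (hP : 0 < P.1 ^ 2 + P.2 ^ 2 - ρ ^ 2) :
    HasFDerivAt (fun P : ℝ × ℝ => max (P.1 ^ 2 + P.2 ^ 2 - ρ ^ 2) 0 ^ a)
      ((a * (P.1 ^ 2 + P.2 ^ 2 - ρ ^ 2) ^ (a - 1)) •
        ((2 * P.1) • ContinuousLinearMap.fst ℝ ℝ ℝ +
          (2 * P.2) • ContinuousLinearMap.snd ℝ ℝ ℝ)) P := by
  have hs : HasFDerivAt (fun P : ℝ × ℝ => P.1 ^ 2 + P.2 ^ 2 - ρ ^ 2)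
      ((2 * P.1) • ContinuousLinearMap.fst ℝ ℝ ℝ +
        (2 * P.2) • ContinuousLinearMap.snd ℝ ℝ ℝ) P := by
    have h := ((hasFDerivAt_fst (𝕜 := ℝ) (p := P)).pow 2 |>.add
      ((hasFDerivAt_snd (𝕜 := ℝ) (p := P)).pow 2)).sub_const (ρ ^ 2)
    exact h.congr_fderiv (by simp)
  refine (hs.rpow_const (p := a) (Or.inl hP.ne')).congr_of_eventuallyEq ?_
  have hcont : Continuous fun P : ℝ × ℝ => P.1 ^ 2 + P.2 ^ 2 - ρ ^ 2 := by fun_prop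
  filter_upwards [hcont.continuousAt.eventually (lt_mem_nhds hP)] with Q hQ
  rw [max_eq_left hQ.le]

theorem contDiffAt_radial_rpow (n : WithTop ℕ∞) (ρ c a : ℝ) {P : ℝ × ℝ}
    (hP : 0 < P.1 ^ 2 + P.2 ^ 2 - ρ ^ 2) :
    ContDiffAt ℝ n (fun P : ℝ × ℝ => c * max (P.1 ^ 2 + P.2 ^ 2 - ρ ^ 2) 0 ^ a) P := by
  have hs : ContDiffAt ℝ n (fun P : ℝ × ℝ => c * (P.1 ^ 2 + P.2 ^ 2 - ρ ^ 2) ^ a) P :=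
    contDiffAt_const.mul (ContDiffAt.rpow_const_of_ne (by fun_prop) hP.ne')
  refine hs.congr_of_eventuallyEq ?_
  have hcont : Continuous fun P : ℝ × ℝ => P.1 ^ 2 + P.2 ^ 2 - ρ ^ 2 := by fun_prop
  filter_upwards [hcont.continuousAt.eventually (lt_mem_nhds hP)] with Q hQ
  rw [max_eq_left hQ.le]

/-- The Hessian determinant of the radial function `c (x² + y² - ρ²)₊ ^ q` outside the disc of
radius `ρ`. -/
theorem detD2_radial_rpow (ρ c q : ℝ) {P : ℝ × ℝ} (hP : 0 < P.1 ^ 2 + P.2 ^ 2 - ρ ^ 2) :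
    detD2 (fun P : ℝ × ℝ => c * max (P.1 ^ 2 + P.2 ^ 2 - ρ ^ 2) 0 ^ q) P =
      4 * c ^ 2 * q ^ 2 * (P.1 ^ 2 + P.2 ^ 2 - ρ ^ 2) ^ (2 * q - 3) *
        ((P.1 ^ 2 + P.2 ^ 2 - ρ ^ 2) + 2 * (q - 1) * (P.1 ^ 2 + P.2 ^ 2)) := by
  have hcont : Continuous fun P : ℝ × ℝ => P.1 ^ 2 + P.2 ^ 2 - ρ ^ 2 := by fun_prop
  have hnear := hcont.continuousAt.eventually (lt_mem_nhds hP)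
  have hx : pdx (fun P : ℝ × ℝ => c * max (P.1 ^ 2 + P.2 ^ 2 - ρ ^ 2) 0 ^ q) =ᶠ[nhds P]
      fun P => 2 * c * q * P.1 * max (P.1 ^ 2 + P.2 ^ 2 - ρ ^ 2) 0 ^ (q - 1) := by
    filter_upwards [hnear] with Q hQ
    rw [pdx, ((hasFDerivAt_radial_rpow ρ q hQ).const_mul c).fderiv, max_eq_left hQ.le]
    simp
    ring
  have hy : pdy (fun P : ℝ × ℝ => c * max (P.1 ^ 2 + P.2 ^ 2 - ρ ^ 2) 0 ^ q) =ᶠ[nhds P]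
      fun P => 2 * c * q * P.2 * max (P.1 ^ 2 + P.2 ^ 2 - ρ ^ 2) 0 ^ (q - 1) := by
    filter_upwards [hnear] with Q hQ
    rw [pdy, ((hasFDerivAt_radial_rpow ρ q hQ).const_mul c).fderiv, max_eq_left hQ.le]
    simp
    ring
  have hdx := ((hasFDerivAt_fst (𝕜 := ℝ) (p := P)).const_mul (2 * c * q)).mul
    (hasFDerivAt_radial_rpow ρ (q - 1) hP)
  have hdy := ((hasFDerivAt_snd (𝕜 := ℝ) (p := P)).const_mul (2 * c * q)).mul
    (hasFDerivAt_radial_rpow ρ (q - 1) hP)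
  have hx' := (hdx.congr_of_eventuallyEq hx).fderiv
  have hy' := (hdy.congr_of_eventuallyEq hy).fderiv
  rw [detD2, pdxx, pdyy, pdxy, pdx, pdy, pdy, hx', hy', max_eq_left hP.le]
  obtain ⟨x, y⟩ := P
  simp only at hP ⊢
  have h1 : (x ^ 2 + y ^ 2 - ρ ^ 2) ^ (q - 1) =
      (x ^ 2 + y ^ 2 - ρ ^ 2) ^ (q - 1 - 1) * (x ^ 2 + y ^ 2 - ρ ^ 2) := by
    rw [← rpow_add_one hP.ne']
    ring_nf
  have h2 : (x ^ 2 + y ^ 2 - ρ ^ 2) ^ (2 * q - 3) =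
      ((x ^ 2 + y ^ 2 - ρ ^ 2) ^ (q - 1 - 1)) ^ 2 * (x ^ 2 + y ^ 2 - ρ ^ 2) := by
    rw [← rpow_mul_natCast hP.le, ← rpow_add_one hP.ne']
    push_cast
    ring_nf
  rw [h2, h1]
  simp
  ring

/-- The exponent `q = 3 / (2 - p)` makes `det D²ψ / ψ ^ p` free of powers of the distance to the
interface. -/
theorem detD2_radial_div_rpow {p c : ℝ} (ρ : ℝ) (hp2 : p < 2) (hc : 0 < c) {P : ℝ × ℝ}
    (hP : 0 < P.1 ^ 2 + P.2 ^ 2 - ρ ^ 2) :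
    detD2 (fun P : ℝ × ℝ => c * max (P.1 ^ 2 + P.2 ^ 2 - ρ ^ 2) 0 ^ (3 / (2 - p))) P /
        (c * max (P.1 ^ 2 + P.2 ^ 2 - ρ ^ 2) 0 ^ (3 / (2 - p))) ^ p =
      4 * c ^ (2 - p) * (3 / (2 - p)) ^ 2 *
        ((P.1 ^ 2 + P.2 ^ 2 - ρ ^ 2) + 2 * (3 / (2 - p) - 1) * (P.1 ^ 2 + P.2 ^ 2)) := by
  have hne : 2 - p ≠ 0 := by linarith
  rw [detD2_radial_rpow ρ c _ hP, max_eq_left hP.le, mul_rpow hc.le (by positivity),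
    ← rpow_mul hP.le, rpow_sub hc, rpow_two,
    show 2 * (3 / (2 - p)) - 3 = 3 / (2 - p) * p by field_simp; ring]
  have h1 := (rpow_pos_of_pos hc p).ne'
  have h2 := (rpow_pos_of_pos hP (3 / (2 - p) * p)).ne'
  generalize (P.1 ^ 2 + P.2 ^ 2 - ρ ^ 2) ^ (3 / (2 - p) * p) = A at *
  field_simp

/-- the radial super-solution example
`ψ₁(P) = c₁·((|P|² − ρ²)₊)^q` with `q = 3/(2−p)`. -/
theorem radial_supersolution_example (p ρ : ℝ)
    (hp0 : 0 < p) (hp2 : p < 2) (hρ0 : 0 < ρ) (hρ1 : ρ < 1) :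
    ∃ c₁ lam : ℝ, 0 < c₁ ∧ 0 < lam ∧ lam < 1 ∧
      ∀ P : ℝ × ℝ, ρ < Real.sqrt (P.1 ^ 2 + P.2 ^ 2) → Real.sqrt (P.1 ^ 2 + P.2 ^ 2) < 1 →
        ContDiffAt ℝ 2
          (fun P : ℝ × ℝ => c₁ * max (P.1 ^ 2 + P.2 ^ 2 - ρ ^ 2) 0 ^ (3 / (2 - p))) P ∧
        2 * lam <
          detD2 (fun P : ℝ × ℝ =>
              c₁ * max (P.1 ^ 2 + P.2 ^ 2 - ρ ^ 2) 0 ^ (3 / (2 - p))) P /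
            (c₁ * max (P.1 ^ 2 + P.2 ^ 2 - ρ ^ 2) 0 ^ (3 / (2 - p))) ^ p ∧
        detD2 (fun P : ℝ × ℝ =>
            c₁ * max (P.1 ^ 2 + P.2 ^ 2 - ρ ^ 2) 0 ^ (3 / (2 - p))) P /
          (c₁ * max (P.1 ^ 2 + P.2 ^ 2 - ρ ^ 2) 0 ^ (3 / (2 - p))) ^ p < 1 / 2 := by
  have hd : 0 < 2 - p := by linarith
  set q := 3 / (2 - p) with hq
  have hq1 : 1 < q := by rw [hq, lt_div_iff₀ hd]; linarith
  have hK : 0 < 1 / (8 * q ^ 2 * (2 * q - 1)) :=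
    one_div_pos.2 (mul_pos (by positivity) (by linarith))
  have hc := rpow_pos_of_pos hK (1 / (2 - p))
  have hcK : ((1 / (8 * q ^ 2 * (2 * q - 1))) ^ (1 / (2 - p))) ^ (2 - p) =
      1 / (8 * q ^ 2 * (2 * q - 1)) := by
    rw [← rpow_mul hK.le, one_div_mul_cancel hd.ne', rpow_one]
  have hden : 0 < 2 * q - 1 := by linarith
  have hρ2 : ρ ^ 2 < 1 := by nlinarith
  refine ⟨_, (q - 1) * ρ ^ 2 / (2 * (2 * q - 1)), hc, ?_, ?_, fun P h1 h2 => ?_⟩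
  · exact div_pos (mul_pos (by linarith) (by positivity)) (by linarith)
  · rw [div_lt_one (by linarith)]
    nlinarith
  rw [lt_sqrt hρ0.le] at h1
  rw [sqrt_lt' one_pos, one_pow] at h2
  have hP : 0 < P.1 ^ 2 + P.2 ^ 2 - ρ ^ 2 := by linarith
  have hcoef : 4 * (1 / (8 * q ^ 2 * (2 * q - 1))) * q ^ 2 = 1 / (2 * (2 * q - 1)) := by
    field_simp
    norm_num
  rw [detD2_radial_div_rpow ρ hp2 hc hP, ← hq, hcK, hcoef]
  refine ⟨contDiffAt_radial_rpow 2 ρ _ q hP, ?_, ?_⟩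
  · rw [← mul_div_assoc, one_div_mul_eq_div]
    apply div_lt_div_of_pos_right _ (by linarith)
    nlinarith
  · rw [one_div_mul_eq_div, div_lt_div_iff₀ (by linarith) two_pos]
    nlinarith

end
end
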